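/- For all real numbers β, δ with δ ≠ 0 and every complex number z with Re z > −β + |δ|, one has ζ_{β,δ}(z) = q^{−β/2}(q^{−1}−q)^z (q^{−δ/2}−q^{δ/2})^{−1} · Σ_{n=0}^∞ (q^{−δ(n+1)} − q^{δ(n+1)}) · q^{(β+z)(n+1)} · (1−q^{2(n+1)})^{−z}, the series on the right converging absolutely. -/

import Mathlib

open Complex Real Filter Finset Topology

/-- The q-number `[x]_q = (q^x - q^{-x})/(q - q⁻¹)`. -/
noncomputable def qnum (q x : ℝ) : ℝ := (q ^ x - q ^ (-x)) / (q - q⁻¹)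

/-- For a positive real `a` and `w : ℂ`, `a^w := exp(w · ln a)`. -/
noncomputable def rcpow (a : ℝ) (w : ℂ) : ℂ := Complex.exp (w * (Real.log a : ℂ))

/-- The `(n,j)`-term of the q-zeta double series, corresponding to
`l = n + 1/2` and `k = j - n - 1/2`: `q^{βl+δk} · [l+1/2]_q^{-z}`. -/
noncomputable def qzetaTerm (q β δ : ℝ) (z : ℂ) (n j : ℕ) : ℂ :=
  ((q ^ (β * ((n : ℝ) + 1/2) + δ * ((j : ℝ) - (n : ℝ) - 1/2)) : ℝ) : ℂ) *
    rcpow (qnum q ((n : ℝ) + 1)) (-z)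

/-- The q-zeta function `ζ_{β,δ}(z)` as a double series. -/
noncomputable def qzeta (q β δ : ℝ) (z : ℂ) : ℂ :=
  ∑' n : ℕ, ∑ j ∈ Finset.range (2 * n + 2), qzetaTerm q β δ z n j

/-- Telescoping evaluation of the symmetric geometric sum `∑ q^{δk}` over `k = -l, …, l`. -/
lemma sum_rpow_symm_mul {q : ℝ} (hq : 0 < q) (δ : ℝ) (n : ℕ) :
    (∑ j ∈ Finset.range (2 * n + 2), q ^ (δ * ((j : ℝ) - (n : ℝ) - 1/2))) *
      (q ^ (-δ / 2) - q ^ (δ / 2)) =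
      q ^ (-δ * ((n : ℝ) + 1)) - q ^ (δ * ((n : ℝ) + 1)) := by
  have hterm (j : ℕ) : q ^ (δ * ((j : ℝ) - n - 1/2)) * (q ^ (-δ / 2) - q ^ (δ / 2)) =
      q ^ (δ * ((j : ℝ) - n - 1)) - q ^ (δ * (((j + 1 : ℕ) : ℝ) - n - 1)) := by
    rw [mul_sub, ← Real.rpow_add hq, ← Real.rpow_add hq]
    push_cast
    ring_nf
  rw [Finset.sum_mul, Finset.sum_congr rfl fun j _ => hterm j,
    Finset.sum_range_sub' (fun j : ℕ => q ^ (δ * ((j : ℝ) - n - 1)))]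
  push_cast
  ring_nf

lemma rpow_neg_half_sub_rpow_half_ne_zero {q : ℝ} (hq0 : 0 < q) (hq1 : q < 1) {δ : ℝ}
    (hδ : δ ≠ 0) : q ^ (-δ / 2) - q ^ (δ / 2) ≠ 0 := by
  intro h
  have := (Real.rpow_right_inj hq0 hq1.ne).1 (sub_eq_zero.1 h)
  exact hδ (by linarith)

lemma one_sub_pow_pos {q : ℝ} (hq0 : 0 < q) (hq1 : q < 1) (n : ℕ) :
    0 < 1 - q ^ (2 * (n + 1)) :=
  sub_pos.2 (pow_lt_one₀ hq0.le hq1 (by lia))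

lemma inv_sub_self_pos {q : ℝ} (hq0 : 0 < q) (hq1 : q < 1) : 0 < q⁻¹ - q :=
  sub_pos.2 (hq1.trans ((one_lt_inv₀ hq0).2 hq1))

lemma log_qnum {q : ℝ} (hq0 : 0 < q) (hq1 : q < 1) (n : ℕ) :
    Real.log (qnum q ((n : ℝ) + 1)) =
      -((n : ℝ) + 1) * Real.log q + Real.log (1 - q ^ (2 * (n + 1))) - Real.log (q⁻¹ - q) := by
  have h1 := one_sub_pow_pos hq0 hq1 n
  have h2 := inv_sub_self_pos hq0 hq1
  have h3 : 0 < q ^ (-((n : ℝ) + 1)) := Real.rpow_pos_of_pos hq0 _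
  have hq : qnum q ((n : ℝ) + 1) =
      q ^ (-((n : ℝ) + 1)) * (1 - q ^ (2 * (n + 1))) / (q⁻¹ - q) := by
    have h4 : q ^ (-((n : ℝ) + 1)) * q ^ (2 * (n + 1)) = q ^ ((n : ℝ) + 1) := by
      rw [← Real.rpow_natCast, ← Real.rpow_add hq0]
      push_cast
      ring_nf
    rw [qnum, mul_sub, h4, ← neg_sub q⁻¹ q, div_neg, ← neg_div]
    ring
  rw [hq, Real.log_div (by positivity) h2.ne', Real.log_mul h3.ne' h1.ne', Real.log_rpow hq0]

lemma norm_rcpow (a : ℝ) (w : ℂ) : ‖rcpow a w‖ = Real.exp (w.re * Real.log a) := by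
  rw [rcpow, Complex.norm_exp, Complex.re_mul_ofReal]

lemma norm_rcpow_one_sub_pow_le {q : ℝ} (hq0 : 0 < q) (hq1 : q < 1) (w : ℂ) (n : ℕ) :
    ‖rcpow (1 - q ^ (2 * (n + 1))) w‖ ≤ Real.exp (|w.re| * |Real.log (1 - q ^ 2)|) := by
  have h0 : 0 < 1 - q ^ 2 := by simpa using one_sub_pow_pos hq0 hq1 0
  have hle : 1 - q ^ 2 ≤ 1 - q ^ (2 * (n + 1)) :=
    sub_le_sub_left (pow_le_pow_of_le_one hq0.le hq1.le (by lia)) 1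
  have hlog := Real.log_le_log h0 hle
  have hneg : Real.log (1 - q ^ (2 * (n + 1))) ≤ 0 :=
    Real.log_nonpos (h0.le.trans hle) (sub_le_self 1 (by positivity))
  rw [norm_rcpow, Real.exp_le_exp]
  calc _ ≤ |w.re * Real.log (1 - q ^ (2 * (n + 1)))| := le_abs_self _
    _ = |w.re| * |Real.log (1 - q ^ (2 * (n + 1)))| := abs_mul _ _
    _ ≤ _ := by
      gcongr 1
      rw [abs_of_nonpos hneg, abs_of_nonpos (hlog.trans hneg)]
      linarith

lemma abs_rpow_sub_rpow_le {q : ℝ} (hq0 : 0 < q) (hq1 : q < 1) (δ : ℝ) {t : ℝ} (ht : 0 ≤ t) :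
    |q ^ (-δ * t) - q ^ (δ * t)| ≤ 2 * q ^ (-|δ| * t) := by
  have h1 : q ^ (-δ * t) ≤ q ^ (-|δ| * t) :=
    Real.rpow_le_rpow_of_exponent_ge hq0 hq1.le
      (mul_le_mul_of_nonneg_right (neg_le_neg (le_abs_self δ)) ht)
  have h2 : q ^ (δ * t) ≤ q ^ (-|δ| * t) :=
    Real.rpow_le_rpow_of_exponent_ge hq0 hq1.le
      (mul_le_mul_of_nonneg_right (neg_abs_le δ) ht)
  have h3 : 0 < q ^ (-δ * t) := Real.rpow_pos_of_pos hq0 _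
  have h4 : 0 < q ^ (δ * t) := Real.rpow_pos_of_pos hq0 _
  rw [abs_le]
  constructor <;> linarith

lemma summable_rpow_mul_succ {q : ℝ} (hq0 : 0 < q) (hq1 : q < 1) {s : ℝ} (hs : 0 < s) :
    Summable fun n : ℕ => q ^ (s * ((n : ℝ) + 1)) := by
  have h : Summable fun n : ℕ => (q ^ s) ^ (n + 1) :=
    (summable_nat_add_iff 1).2 (summable_geometric_of_lt_one (by positivity)
      (Real.rpow_lt_one hq0.le hq1 hs))
  refine h.congr fun n => ?_
  rw [Real.rpow_mul hq0.le, ← Real.rpow_natCast]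
  push_cast
  rfl

lemma norm_rcpow_mul_succ {q : ℝ} (hq0 : 0 < q) (β : ℝ) (z : ℂ) (n : ℕ) :
    ‖rcpow q (((β : ℂ) + z) * ((n : ℕ) + 1 : ℂ))‖ = q ^ ((β + z.re) * ((n : ℝ) + 1)) := by
  rw [norm_rcpow, Real.rpow_def_of_pos hq0, mul_comm]
  congr 2
  simp

lemma sum_qzetaTerm {q : ℝ} (hq0 : 0 < q) (hq1 : q < 1) (β : ℝ) {δ : ℝ} (hδ : δ ≠ 0)
    (z : ℂ) (n : ℕ) :
    ∑ j ∈ Finset.range (2 * n + 2), qzetaTerm q β δ z n j =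
      ((q ^ (-β / 2) : ℝ) : ℂ) * rcpow (q⁻¹ - q) z *
        (((q ^ (-δ / 2) - q ^ (δ / 2) : ℝ) : ℂ))⁻¹ *
        (((q ^ (-δ * ((n : ℝ) + 1)) - q ^ (δ * ((n : ℝ) + 1)) : ℝ) : ℂ) *
          rcpow q (((β : ℂ) + z) * ((n : ℕ) + 1 : ℂ)) *
          rcpow (1 - q ^ (2 * (n + 1))) (-z)) := by
  have hD : ((q ^ (-δ / 2) - q ^ (δ / 2) : ℝ) : ℂ) ≠ 0 :=
    Complex.ofReal_ne_zero.2 (rpow_neg_half_sub_rpow_half_ne_zero hq0 hq1 hδ)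
  have hsum : ∑ j ∈ Finset.range (2 * n + 2), qzetaTerm q β δ z n j =
      ((∑ j ∈ Finset.range (2 * n + 2), q ^ (δ * ((j : ℝ) - (n : ℝ) - 1/2)) : ℝ) : ℂ) *
        (((q ^ (β * ((n : ℝ) + 1/2)) : ℝ) : ℂ) * rcpow (qnum q ((n : ℝ) + 1)) (-z)) := by
    rw [Complex.ofReal_sum, Finset.sum_mul]
    refine Finset.sum_congr rfl fun j _ => ?_
    rw [qzetaTerm, Real.rpow_add hq0, Complex.ofReal_mul]
    ring
  have hexp : ((q ^ (β * ((n : ℝ) + 1/2)) : ℝ) : ℂ) * rcpow (qnum q ((n : ℝ) + 1)) (-z) =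
      ((q ^ (-β / 2) : ℝ) : ℂ) * rcpow (q⁻¹ - q) z *
        (rcpow q (((β : ℂ) + z) * ((n : ℕ) + 1 : ℂ)) * rcpow (1 - q ^ (2 * (n + 1))) (-z)) := by
    simp only [rcpow, log_qnum hq0 hq1, Real.rpow_def_of_pos hq0, Complex.ofReal_exp,
      ← Complex.exp_add]
    congr 1
    push_cast
    ring
  rw [hsum, hexp, ← sum_rpow_symm_mul hq0 δ n, Complex.ofReal_mul]
  generalize ((q ^ (-δ / 2) - q ^ (δ / 2) : ℝ) : ℂ) = D at hD ⊢
  generalize ((∑ j ∈ Finset.range (2 * n + 2), q ^ (δ * ((j : ℝ) - (n : ℝ) - 1/2)) : ℝ) : ℂ) = S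
  field_simp

theorem statement6 (q : ℝ) (hq0 : 0 < q) (hq1 : q < 1) (β δ : ℝ) (hδ : δ ≠ 0)
    (z : ℂ) (hz : -β + |δ| < z.re) :
    Summable (fun n : ℕ =>
      ‖((q ^ (-δ * ((n : ℝ) + 1)) - q ^ (δ * ((n : ℝ) + 1)) : ℝ) : ℂ) *
        rcpow q (((β : ℂ) + z) * ((n : ℕ) + 1 : ℂ)) *
        rcpow (1 - q ^ (2 * (n + 1))) (-z)‖) ∧
    qzeta q β δ z =
      ((q ^ (-β / 2) : ℝ) : ℂ) * rcpow (q⁻¹ - q) z *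
        (((q ^ (-δ / 2) - q ^ (δ / 2) : ℝ) : ℂ))⁻¹ *
        ∑' n : ℕ, ((q ^ (-δ * ((n : ℝ) + 1)) - q ^ (δ * ((n : ℝ) + 1)) : ℝ) : ℂ) *
          rcpow q (((β : ℂ) + z) * ((n : ℕ) + 1 : ℂ)) *
          rcpow (1 - q ^ (2 * (n + 1))) (-z) := by
  refine ⟨?_, ?_⟩
  · have hs : 0 < β + z.re - |δ| := by linarith
    refine Summable.of_nonneg_of_le (fun _ => norm_nonneg _) (fun n => ?_)
      ((summable_rpow_mul_succ hq0 hq1 hs).mul_left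
        (2 * Real.exp (|(-z).re| * |Real.log (1 - q ^ 2)|)))
    rw [norm_mul, norm_mul, norm_rcpow_mul_succ hq0, Complex.norm_real, Real.norm_eq_abs]
    calc _ ≤ 2 * q ^ (-|δ| * ((n : ℝ) + 1)) * q ^ ((β + z.re) * ((n : ℝ) + 1)) *
          Real.exp (|(-z).re| * |Real.log (1 - q ^ 2)|) := by
          gcongr
          · exact abs_rpow_sub_rpow_le hq0 hq1 δ (by positivity)
          · exact norm_rcpow_one_sub_pow_le hq0 hq1 (-z) n
      _ = _ := by
          rw [mul_assoc 2, ← Real.rpow_add hq0, mul_right_comm]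
          ring_nf
  · rw [qzeta, ← tsum_mul_left]
    exact tsum_congr fun n => sum_qzetaTerm hq0 hq1 β hδ z n
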